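/- Let ρ > 0, λ > 0, let f be continuous on Π_ρ with f ≥ 0 there, and H a functional with H[u] ≥ 0, and suppose u ∈ ∂K_ρ satisfies u(t) = λ ( γ(t) H[u] + ∫₀¹ k(t,s) f(s, u(s), u′(s), u″(s), u‴(s)) ds ) on [0,1]. Then ‖u‴‖_∞ = λ ( H[u] + ∫₀¹ f(s, u(s), u′(s), u″(s), u‴(s)) ds ) and ρ = ‖u‖₃ = ‖u‴‖_∞. -/

import Mathlib

open Set MeasureTheory Filter Topology

/-- The Green's function `k(t,s) = (1/6)(3t²s − t³)` for `s ≥ t`,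
`k(t,s) = (1/6)(3s²t − s³)` for `s ≤ t`. -/
noncomputable def kern (t s : ℝ) : ℝ :=
  if t ≤ s then (3 * t ^ 2 * s - t ^ 3) / 6 else (3 * s ^ 2 * t - s ^ 3) / 6

/-- `γ(t) = (1/6)(3t² − t³)`. -/
noncomputable def gam (t : ℝ) : ℝ := (3 * t ^ 2 - t ^ 3) / 6

/-- The sup norm over `[0,1]`: `‖w‖_∞ = sup_{t∈[0,1]} |w(t)|`. -/
noncomputable def supN (w : ℝ → ℝ) : ℝ := ⨆ t : Icc (0:ℝ) 1, |w ↑t|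

/-- The `C³[0,1]` norm `‖u‖₃ = max_{j=0,…,3} ‖u⁽ʲ⁾‖_∞`. -/
noncomputable def norm3 (u : ℝ → ℝ) : ℝ :=
  max (max (supN u) (supN (deriv u))) (max (supN (deriv^[2] u)) (supN (deriv^[3] u)))

/-- The cone `K = {u ∈ C³[0,1] : u, u′, u″, −u‴ ≥ 0 on [0,1]}`, where elements of
`C³[0,1]` are represented by three times continuously differentiable functions on `ℝ`. -/
def coneK : Set (ℝ → ℝ) :=
  {u | ContDiff ℝ 3 u ∧ ∀ t ∈ Icc (0:ℝ) 1,
    0 ≤ u t ∧ 0 ≤ deriv u t ∧ 0 ≤ deriv^[2] u t ∧ 0 ≤ -(deriv^[3] u t)}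

/-- `K̄_ρ = {u ∈ K : ‖u‖₃ ≤ ρ}`. -/
def Kbar (ρ : ℝ) : Set (ℝ → ℝ) := {u ∈ coneK | norm3 u ≤ ρ}

/-- `∂K_ρ = {u ∈ K : ‖u‖₃ = ρ}`. -/
def Kbdry (ρ : ℝ) : Set (ℝ → ℝ) := {u ∈ coneK | norm3 u = ρ}

/-- `Π_ρ = [0,1] × [0,ρ]³ × [−ρ,0]`. -/
def PiSet (ρ : ℝ) : Set (ℝ × ℝ × ℝ × ℝ × ℝ) :=
  {p | p.1 ∈ Icc (0:ℝ) 1 ∧ p.2.1 ∈ Icc 0 ρ ∧ p.2.2.1 ∈ Icc 0 ρ ∧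
       p.2.2.2.1 ∈ Icc 0 ρ ∧ p.2.2.2.2 ∈ Icc (-ρ) 0}

/-- The operator `Tu(t) = γ(t)H[u] + ∫₀¹ k(t,s) f(s, u(s), u′(s), u″(s), u‴(s)) ds`. -/
noncomputable def Toper (f : ℝ × ℝ × ℝ × ℝ × ℝ → ℝ) (H : (ℝ → ℝ) → ℝ) (u : ℝ → ℝ) :
    ℝ → ℝ :=
  fun t => gam t * H u +
    ∫ s in (0:ℝ)..1, kern t s * f (s, u s, deriv u s, deriv^[2] u s, deriv^[3] u s)

/-- Continuity of a functional `H` on a subset `S` of `C³[0,1]` with respect to `‖·‖₃`. -/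
def ContOn3 (H : (ℝ → ℝ) → ℝ) (S : Set (ℝ → ℝ)) : Prop :=
  ∀ u ∈ S, ∀ ε > (0:ℝ), ∃ δ > (0:ℝ), ∀ v ∈ S, norm3 (u - v) < δ → |H u - H v| < ε

/-- Boundedness of a functional `H` on a subset `S` of `C³[0,1]`. -/
def BddOn3 (H : (ℝ → ℝ) → ℝ) (S : Set (ℝ → ℝ)) : Prop :=
  ∃ M : ℝ, ∀ u ∈ S, |H u| ≤ M

theorem abs_le_supN {w : ℝ → ℝ} (hw : ContinuousOn w (Icc 0 1)) {t : ℝ}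
    (ht : t ∈ Icc (0 : ℝ) 1) : |w t| ≤ supN w := by
  have hb : BddAbove (range fun s : Icc (0 : ℝ) 1 => |w ↑s|) := by
    have := (isCompact_Icc.image_of_continuousOn hw.abs).bddAbove
    rwa [image_eq_range] at this
  exact le_ciSup hb ⟨t, ht⟩

theorem supN_le {w : ℝ → ℝ} {M : ℝ} (h : ∀ t ∈ Icc (0 : ℝ) 1, |w t| ≤ M) : supN w ≤ M :=
  haveI : Nonempty (Icc (0 : ℝ) 1) := ⟨⟨0, by simp⟩⟩
  ciSup_le fun t => h t t.2

/-- A function vanishing at a point of `[0,1]` is bounded there by the sup norm of its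
derivative. -/
theorem abs_le_of_abs_deriv_le {w : ℝ → ℝ} {M a : ℝ} (hw : Differentiable ℝ w)
    (h : ∀ t ∈ Icc (0 : ℝ) 1, |deriv w t| ≤ M) (ha : a ∈ Icc (0 : ℝ) 1) (hwa : w a = 0) :
    ∀ t ∈ Icc (0 : ℝ) 1, |w t| ≤ M := by
  intro t ht
  have hM : 0 ≤ M := (abs_nonneg _).trans (h a ha)
  have := (convex_Icc (0 : ℝ) 1).norm_image_sub_le_of_norm_deriv_le
    (fun x _ => hw x) (fun x hx => h x hx) ha ht
  rw [hwa, sub_zero, Real.norm_eq_abs, Real.norm_eq_abs] at this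
  have hta : |t - a| ≤ 1 := abs_le.2 ⟨by linarith [ht.1, ha.2], by linarith [ht.2, ha.1]⟩
  nlinarith

/-- Functions that agree on `[0,1]` have derivatives that agree on `[0,1]`, provided the
derivatives are continuous. -/
theorem deriv_eqOn_Icc {u U V : ℝ → ℝ} (hu : Continuous (deriv u)) (hV : Continuous V)
    (hU : ∀ t, HasDerivAt U (V t) t) (h : EqOn u U (Icc 0 1)) :
    EqOn (deriv u) V (Icc 0 1) := by
  have h1 : EqOn (deriv u) V (Ioo 0 1) := by
    intro t ht
    have : u =ᶠ[𝓝 t] U := by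
      filter_upwards [Ioo_mem_nhds ht.1 ht.2] with s hs using h (Ioo_subset_Icc_self hs)
    rw [this.deriv_eq, (hU t).deriv]
  have := h1.closure hu hV
  rwa [closure_Ioo zero_ne_one] at this

/-- The integral of the Green's function against `G`, expressed through moments of `G`. -/
theorem integral_kern_mul {G : ℝ → ℝ} (hG : Continuous G) {t : ℝ} (ht : t ∈ Icc (0 : ℝ) 1) :
    ∫ s in (0 : ℝ)..1, kern t s * G s =
      t / 2 * (∫ s in (0 : ℝ)..t, s ^ 2 * G s) - (∫ s in (0 : ℝ)..t, s ^ 3 * G s) / 6 +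
      t ^ 2 / 2 * ((∫ s in (0 : ℝ)..1, s * G s) - ∫ s in (0 : ℝ)..t, s * G s) -
      t ^ 3 / 6 * ((∫ s in (0 : ℝ)..1, G s) - ∫ s in (0 : ℝ)..t, G s) := by
  have hint : ∀ (p : ℝ → ℝ) (_ : Continuous p) (a b : ℝ),
      IntervalIntegrable p volume a b := fun p hp a b => hp.intervalIntegrable a b
  have e1 : EqOn (fun s => kern t s * G s)
      (fun s => t / 2 * (s ^ 2 * G s) - 1 / 6 * (s ^ 3 * G s)) (uIcc 0 t) := by
    intro s hs
    rw [uIcc_of_le ht.1] at hs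
    simp only [kern]
    split_ifs with h
    · have : s = t := le_antisymm hs.2 h
      subst this
      ring
    · ring
  have e2 : EqOn (fun s => kern t s * G s)
      (fun s => t ^ 2 / 2 * (s * G s) - t ^ 3 / 6 * G s) (uIcc t 1) := by
    intro s hs
    rw [uIcc_of_le ht.2] at hs
    simp only [kern, if_pos hs.1]
    ring
  have i1 : IntervalIntegrable (fun s => kern t s * G s) volume 0 t :=
    IntervalIntegrable.congr (fun s hs => (e1 (uIoc_subset_uIcc hs)).symm)
      (hint _ (by fun_prop) 0 t)
  have i2 : IntervalIntegrable (fun s => kern t s * G s) volume t 1 :=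
    IntervalIntegrable.congr (fun s hs => (e2 (uIoc_subset_uIcc hs)).symm)
      (hint _ (by fun_prop) t 1)
  rw [← intervalIntegral.integral_add_adjacent_intervals i1 i2,
    intervalIntegral.integral_congr e1, intervalIntegral.integral_congr e2,
    intervalIntegral.integral_sub (hint _ (by fun_prop) _ _) (hint _ (by fun_prop) _ _),
    intervalIntegral.integral_sub (hint _ (by fun_prop) _ _) (hint _ (by fun_prop) _ _),
    intervalIntegral.integral_const_mul, intervalIntegral.integral_const_mul,
    intervalIntegral.integral_const_mul, intervalIntegral.integral_const_mul,
    ← intervalIntegral.integral_interval_sub_left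
      (hint (fun s => s * G s) (by fun_prop) 0 1) (hint _ (by fun_prop) 0 t),
    ← intervalIntegral.integral_interval_sub_left (hint G hG 0 1) (hint _ hG 0 t)]
  ring

/-- The derivatives on `[0,1]` of a solution of the linear Hammerstein equation with
continuous source `G`. -/
theorem derivs_of_eq_integral_kern {u G : ℝ → ℝ} {lam h : ℝ} (hu : ContDiff ℝ 3 u)
    (hG : Continuous G)
    (heq : ∀ t ∈ Icc (0 : ℝ) 1, u t = lam * (gam t * h + ∫ s in (0 : ℝ)..1, kern t s * G s)) :
    u 0 = 0 ∧ deriv u 0 = 0 ∧ deriv^[2] u 1 = 0 ∧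
      ∀ t ∈ Icc (0 : ℝ) 1, deriv^[3] u t = -(lam * (h + ∫ s in t..1, G s)) := by
  have hcont : ∀ n ≤ 3, Continuous (deriv^[n] u) := by
    intro n hn
    rw [← iteratedDeriv_eq_iterate]
    exact hu.continuous_iteratedDeriv n (by exact_mod_cast hn)
  set A : ℕ → ℝ → ℝ := fun n t => ∫ s in (0 : ℝ)..t, s ^ n * G s with hA
  have dA : ∀ n t, HasDerivAt (A n) (t ^ n * G t) t := fun n t =>
    (show Continuous fun s : ℝ => s ^ n * G s by fun_prop).integral_hasStrictDerivAt 0 t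
      |>.hasDerivAt
  have cA : ∀ n, Continuous (A n) := fun n =>
    continuous_iff_continuousAt.2 fun t => (dA n t).continuousAt
  set U : ℝ → ℝ := fun t => lam * (gam t * h + (t / 2 * A 2 t - A 3 t / 6 +
    t ^ 2 / 2 * (A 1 1 - A 1 t) - t ^ 3 / 6 * (A 0 1 - A 0 t))) with hU
  set U₁ : ℝ → ℝ := fun t => lam * ((t - t ^ 2 / 2) * h + (A 2 t / 2 +
    t * (A 1 1 - A 1 t) - t ^ 2 / 2 * (A 0 1 - A 0 t))) with hU₁
  set U₂ : ℝ → ℝ := fun t => lam * ((1 - t) * h +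
    ((A 1 1 - A 1 t) - t * (A 0 1 - A 0 t))) with hU₂
  set U₃ : ℝ → ℝ := fun t => -(lam * (h + (A 0 1 - A 0 t))) with hU₃
  have c1 : Continuous U₁ := by have := cA; fun_prop
  have c2 : Continuous U₂ := by have := cA; fun_prop
  have c3 : Continuous U₃ := by have := cA; fun_prop
  have d2 : ∀ t, HasDerivAt U₂ (U₃ t) t := by
    intro t
    have h0 := (hasDerivAt_const t (A 0 1)).sub (dA 0 t)
    have h1 := (hasDerivAt_const t (A 1 1)).sub (dA 1 t)
    have hp := ((hasDerivAt_id t).const_sub 1).mul_const h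
    refine ((hp.add (h1.sub ((hasDerivAt_id t).mul h0))).const_mul lam).congr_deriv ?_
    simp only [hU₃, id, Pi.sub_apply]
    ring
  have d1 : ∀ t, HasDerivAt U₁ (U₂ t) t := by
    intro t
    have h0 := (hasDerivAt_const t (A 0 1)).sub (dA 0 t)
    have h1 := (hasDerivAt_const t (A 1 1)).sub (dA 1 t)
    have hsq := (hasDerivAt_pow 2 t).div_const 2
    have hp := ((hasDerivAt_id t).sub hsq).mul_const h
    refine ((hp.add ((((dA 2 t).div_const 2).add ((hasDerivAt_id t).mul h1)).sub
      (hsq.mul h0))).const_mul lam).congr_deriv ?_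
    simp only [hU₂, id, Pi.sub_apply]
    ring
  have d0 : ∀ t, HasDerivAt U (U₁ t) t := by
    intro t
    have h0 := (hasDerivAt_const t (A 0 1)).sub (dA 0 t)
    have h1 := (hasDerivAt_const t (A 1 1)).sub (dA 1 t)
    have hsq := (hasDerivAt_pow 2 t).div_const 2
    have hcu := (hasDerivAt_pow 3 t).div_const 6
    have hp := ((((hasDerivAt_pow 2 t).const_mul 3).sub (hasDerivAt_pow 3 t)).div_const
      6).mul_const h
    refine ((hp.add (((((hasDerivAt_id t).div_const 2).mul (dA 2 t)).sub
      ((dA 3 t).div_const 6)).add (hsq.mul h1) |>.sub (hcu.mul h0))).const_mul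
      lam).congr_deriv ?_
    simp only [hU₁, id, Pi.sub_apply]
    ring
  have e0 : EqOn u U (Icc 0 1) := by
    intro t ht
    rw [heq t ht, integral_kern_mul hG ht]
    simp only [hU, hA, pow_zero, pow_one, one_mul]
  have e1 : EqOn (deriv u) U₁ (Icc 0 1) := deriv_eqOn_Icc (hcont 1 (by norm_num)) c1 d0 e0
  have hit : ∀ n, deriv^[n + 1] u = deriv (deriv^[n] u) := fun n =>
    Function.iterate_succ_apply' deriv n u
  have e2 : EqOn (deriv^[2] u) U₂ (Icc 0 1) := by
    rw [hit 1]
    exact deriv_eqOn_Icc (hit 1 ▸ hcont 2 (by norm_num)) c2 d1 e1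
  have e3 : EqOn (deriv^[3] u) U₃ (Icc 0 1) := by
    rw [hit 2]
    exact deriv_eqOn_Icc (hit 2 ▸ hcont 3 le_rfl) c3 d2 e2
  have m0 : (0 : ℝ) ∈ Icc (0 : ℝ) 1 := by simp
  have m1 : (1 : ℝ) ∈ Icc (0 : ℝ) 1 := by simp
  refine ⟨?_, ?_, ?_, fun t ht => ?_⟩
  · rw [e0 m0]
    simp [hU, hA, gam]
  · rw [e1 m0]
    simp [hU₁, hA]
  · rw [e2 m1]
    simp [hU₂]
  · rw [e3 ht]
    simp only [hU₃, hA, pow_zero, one_mul]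
    rw [intervalIntegral.integral_interval_sub_left (hG.intervalIntegrable 0 1)
      (hG.intervalIntegrable 0 t)]

/-- If `u ∈ ∂K_ρ` satisfies the perturbed Hammerstein integral equation with `λ > 0`,
`f ≥ 0` continuous on `Π_ρ` and `H[u] ≥ 0`, then
`‖u‴‖_∞ = λ(H[u] + ∫₀¹ f(s,u(s),u′(s),u″(s),u‴(s)) ds)` and `ρ = ‖u‖₃ = ‖u‴‖_∞`. -/
theorem third_deriv_norm_identity
    (ρ lam : ℝ) (hρ : 0 < ρ) (hlam : 0 < lam)
    (f : ℝ × ℝ × ℝ × ℝ × ℝ → ℝ) (hfc : ContinuousOn f (PiSet ρ))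
    (hf0 : ∀ p ∈ PiSet ρ, 0 ≤ f p)
    (H : (ℝ → ℝ) → ℝ)
    (u : ℝ → ℝ) (hu : u ∈ Kbdry ρ) (hH0 : 0 ≤ H u)
    (heq : ∀ t ∈ Icc (0:ℝ) 1, u t = lam * Toper f H u t) :
    supN (deriv^[3] u) = lam * (H u +
      ∫ s in (0:ℝ)..1, f (s, u s, deriv u s, deriv^[2] u s, deriv^[3] u s)) ∧
    ρ = norm3 u ∧ norm3 u = supN (deriv^[3] u) := by
  obtain ⟨⟨hC, hsign⟩, hnorm⟩ := hu
  have hcont : ∀ n ≤ 3, Continuous (deriv^[n] u) := by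
    intro n hn
    rw [← iteratedDeriv_eq_iterate]
    exact hC.continuous_iteratedDeriv n (by exact_mod_cast hn)
  have k0 : Continuous u := hcont 0 (by norm_num)
  have k1 : Continuous (deriv u) := hcont 1 (by norm_num)
  have k2 := hcont 2 (by norm_num)
  have k3 := hcont 3 le_rfl
  have hmem : ∀ s ∈ Icc (0 : ℝ) 1,
      (s, u s, deriv u s, deriv^[2] u s, deriv^[3] u s) ∈ PiSet ρ := by
    intro s hs
    obtain ⟨n0, n1, n2, n3⟩ := hsign s hs
    have b0 := (le_abs_self _).trans (abs_le_supN k0.continuousOn hs)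
    have b1 := (le_abs_self _).trans (abs_le_supN k1.continuousOn hs)
    have b2 := (le_abs_self _).trans (abs_le_supN k2.continuousOn hs)
    have b3 := (neg_le_abs _).trans (abs_le_supN k3.continuousOn hs)
    have hmax := hnorm.le
    simp only [norm3, max_le_iff] at hmax
    obtain ⟨⟨r0, r1⟩, r2, r3⟩ := hmax
    exact ⟨hs, ⟨n0, b0.trans r0⟩, ⟨n1, b1.trans r1⟩, ⟨n2, b2.trans r2⟩,
      by linarith, by linarith⟩
  set F : ℝ → ℝ := fun s => f (s, u s, deriv u s, deriv^[2] u s, deriv^[3] u s) with hF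
  have hFc : ContinuousOn F (Icc 0 1) := hfc.comp
    (continuous_id.prodMk (k0.prodMk (k1.prodMk (k2.prodMk k3)))).continuousOn hmem
  set G : ℝ → ℝ := fun s => F (max 0 (min s 1)) with hGdef
  have hclamp : ∀ s : ℝ, max 0 (min s 1) ∈ Icc (0 : ℝ) 1 := fun s =>
    ⟨le_max_left _ _, max_le zero_le_one (min_le_right _ _)⟩
  have hG : Continuous G := hFc.comp_continuous (by fun_prop) hclamp
  have hG0 : ∀ s, 0 ≤ G s := fun s => hf0 _ (hmem _ (hclamp s))
  have hFG : ∀ s ∈ Icc (0 : ℝ) 1, F s = G s := by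
    intro s hs
    simp only [hGdef, min_eq_left hs.2, max_eq_right hs.1]
  have hint : ∫ s in (0 : ℝ)..1, F s = ∫ s in (0 : ℝ)..1, G s :=
    intervalIntegral.integral_congr fun s hs => hFG s (by rwa [uIcc_of_le zero_le_one] at hs)
  obtain ⟨z0, z1, z2, h3⟩ := derivs_of_eq_integral_kern (lam := lam) (h := H u) hC hG (by
    intro t ht
    rw [heq t ht, Toper]
    congr 2
    refine intervalIntegral.integral_congr fun s hs => ?_
    rw [uIcc_of_le zero_le_one] at hs
    exact congrArg (kern t s * ·) (hFG s hs))
  have m0 : (0 : ℝ) ∈ Icc (0 : ℝ) 1 := by simp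
  have m1 : (1 : ℝ) ∈ Icc (0 : ℝ) 1 := by simp
  have hsup : supN (deriv^[3] u) = lam * (H u + ∫ s in (0 : ℝ)..1, F s) := by
    rw [hint]
    apply le_antisymm
    · refine supN_le fun t ht => ?_
      have hnn : 0 ≤ ∫ s in t..1, G s := intervalIntegral.integral_nonneg ht.2 fun s _ => hG0 s
      have hle : ∫ s in t..1, G s ≤ ∫ s in (0 : ℝ)..1, G s := by
        rw [← intervalIntegral.integral_add_adjacent_intervals
          (hG.intervalIntegrable 0 t) (hG.intervalIntegrable t 1)]
        have := intervalIntegral.integral_nonneg (μ := volume) ht.1 fun s _ => hG0 s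
        linarith
      rw [h3 t ht, abs_neg, abs_of_nonneg (by positivity)]
      gcongr
    · have := (neg_le_abs _).trans (abs_le_supN k3.continuousOn m0)
      rwa [h3 0 m0, neg_neg] at this
  have hdiff : ∀ n < 3, Differentiable ℝ (deriv^[n] u) := by
    intro n hn
    rw [← iteratedDeriv_eq_iterate]
    exact hC.differentiable_iteratedDeriv n (by exact_mod_cast hn)
  have B3 : ∀ t ∈ Icc (0 : ℝ) 1, |deriv (deriv^[2] u) t| ≤ supN (deriv^[3] u) := by
    intro t ht
    rw [← Function.iterate_succ_apply' deriv 2 u]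
    exact abs_le_supN k3.continuousOn ht
  have B2 := abs_le_of_abs_deriv_le (hdiff 2 (by norm_num)) B3 m1 z2
  have B1 := abs_le_of_abs_deriv_le (w := deriv u) (hdiff 1 (by norm_num)) B2 m0 z1
  have B0 := abs_le_of_abs_deriv_le (w := u) (hdiff 0 (by norm_num)) B1 m0 z0
  exact ⟨hsup, hnorm.symm, le_antisymm
    (max_le (max_le (supN_le B0) (supN_le B1)) (max_le (supN_le B2) le_rfl))
    ((le_max_right _ _).trans (le_max_right _ _))⟩
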